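/- Let ξ be a real random variable with mean zero and variance 1 which is supported on at least three points. Then there exist 0 < t < 1 and independent real random variables ξ' and ξ_G, each with mean zero and variance 1, with ξ_G standard Gaussian N(0,1), such that ξ matches to order 4 with (1−t)^{1/2} ξ' + t^{1/2} ξ_G, i.e. E[ξ^m] = E[((1−t)^{1/2} ξ' + t^{1/2} ξ_G)^m] for all integers 0 ≤ m ≤ 4. -/

import Mathlib

open MeasureTheory ProbabilityTheory

lemma gauss_moments :
    (∫ x, x ∂(gaussianReal 0 1)) = 0 ∧ (∫ x, x ^ 2 ∂(gaussianReal 0 1)) = 1 ∧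
    (∫ x, x ^ 3 ∂(gaussianReal 0 1)) = 0 ∧ (∫ x, x ^ 4 ∂(gaussianReal 0 1)) = 3 := by
  have key : ∀ n : ℕ, iteratedDeriv n (fun t : ℝ => Real.exp (t ^ 2 / 2)) 0
      = ∫ x, x ^ n ∂(gaussianReal 0 1) := by
    intro n
    have h := iteratedDeriv_mgf_zero (X := id) (μ := gaussianReal 0 1) (by simp) n
    rw [mgf_id_gaussianReal] at h
    simpa using h
  have step : ∀ (p q : ℝ → ℝ), (∀ t, HasDerivAt p (q t) t) →
      deriv (fun t : ℝ => p t * Real.exp (t ^ 2 / 2)) =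
        fun t => (q t + t * p t) * Real.exp (t ^ 2 / 2) := by
    intro p q h
    funext t
    have h1 : HasDerivAt (fun t : ℝ => t ^ 2 / 2) t t := by
      have := (hasDerivAt_pow 2 t).div_const 2
      simpa using this
    have h2 := (h t).mul h1.exp
    refine h2.deriv.trans ?_
    ring
  have d1 : iteratedDeriv 1 (fun t : ℝ => Real.exp (t ^ 2 / 2)) =
      fun t => t * Real.exp (t ^ 2 / 2) := by
    rw [iteratedDeriv_one]
    have := step (fun _ => 1) (fun _ => 0) (fun t => hasDerivAt_const t 1)
    simpa using this
  have d2 : iteratedDeriv 2 (fun t : ℝ => Real.exp (t ^ 2 / 2)) =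
      fun t => (1 + t * t) * Real.exp (t ^ 2 / 2) := by
    rw [iteratedDeriv_succ, d1]
    exact step (fun t => t) (fun _ => 1) (fun t => hasDerivAt_id t)
  have d3 : iteratedDeriv 3 (fun t : ℝ => Real.exp (t ^ 2 / 2)) =
      fun t => ((t + t) + t * (1 + t * t)) * Real.exp (t ^ 2 / 2) := by
    rw [iteratedDeriv_succ, d2]
    refine step (fun t => 1 + t * t) (fun t => t + t) (fun t => ?_)
    have := ((hasDerivAt_id t).mul (hasDerivAt_id t)).const_add 1
    convert! this using 1
    simp
  have d4 : iteratedDeriv 4 (fun t : ℝ => Real.exp (t ^ 2 / 2)) =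
      fun t => ((3 + 3 * t ^ 2) + t * ((t + t) + t * (1 + t * t))) * Real.exp (t ^ 2 / 2) := by
    rw [iteratedDeriv_succ, d3]
    refine step (fun t => (t + t) + t * (1 + t * t)) (fun t => 3 + 3 * t ^ 2) (fun t => ?_)
    have h1 := ((hasDerivAt_id t).const_mul 3).add (hasDerivAt_pow 3 t)
    convert! h1 using 1
    · funext t
      simp
      ring
    · simp
  have k2 := key 2
  have k3 := key 3
  have k4 := key 4
  rw [d2] at k2
  rw [d3] at k3
  rw [d4] at k4
  norm_num at k2 k3 k4
  exact ⟨integral_id_gaussianReal, k2.symm, k3.symm, k4.symm⟩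

lemma gauss_integrable (n : ℕ) : Integrable (fun x : ℝ => x ^ n) (gaussianReal 0 1) := by
  have := (memLp_id_gaussianReal (μ := 0) (v := 1) n).integrable_norm_pow'
  refine (integrable_norm_iff (by fun_prop)).1 ?_
  simpa using this

/-- Moments of independent sums. -/
lemma prod_moment (μ γ : Measure ℝ) [IsProbabilityMeasure μ] [IsProbabilityMeasure γ]
    (hμ : ∀ n : ℕ, Integrable (fun x : ℝ => x ^ n) μ)
    (hγ : ∀ n : ℕ, Integrable (fun x : ℝ => x ^ n) γ) (a b : ℝ) (m : ℕ) :
    ∫ p : ℝ × ℝ, (a * p.1 + b * p.2) ^ m ∂(μ.prod γ) =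
      ∑ k ∈ Finset.range (m + 1), (a ^ k * b ^ (m - k) * (m.choose k)) *
        ((∫ x, x ^ k ∂μ) * ∫ x, x ^ (m - k) ∂γ) := by
  have : ∀ p : ℝ × ℝ, (a * p.1 + b * p.2) ^ m = ∑ k ∈ Finset.range (m + 1),
      (a ^ k * b ^ (m - k) * (m.choose k)) * (p.1 ^ k * p.2 ^ (m - k)) := by
    intro p
    rw [add_pow]
    refine Finset.sum_congr rfl fun k _ => ?_
    rw [mul_pow, mul_pow]
    ring
  simp_rw [this]
  rw [integral_finsetSum]
  · refine Finset.sum_congr rfl fun k _ => ?_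
    rw [integral_const_mul]
    congr 1
    exact integral_prod_mul (fun x : ℝ => x ^ k) (fun x : ℝ => x ^ (m - k))
  · intro k _
    exact ((hμ k).mul_prod (hγ (m - k))).const_mul _

/-- Three-point measures. -/
lemma three_point (x₁ x₂ x₃ w₁ w₂ w₃ : ℝ) (h₁ : 0 ≤ w₁) (h₂ : 0 ≤ w₂) (h₃ : 0 ≤ w₃)
    (hw : w₁ + w₂ + w₃ = 1) :
    ∃ μ : Measure ℝ, IsProbabilityMeasure μ ∧
      ∀ n : ℕ, Integrable (fun x : ℝ => x ^ n) μ ∧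
        ∫ x, x ^ n ∂μ = w₁ * x₁ ^ n + w₂ * x₂ ^ n + w₃ * x₃ ^ n := by
  have hi : ∀ (n : ℕ) (a w : ℝ), Integrable (fun x : ℝ => x ^ n)
      (ENNReal.ofReal w • Measure.dirac a) := fun n a w =>
    (integrable_dirac (by simp)).smul_measure (by simp)
  refine ⟨ENNReal.ofReal w₁ • Measure.dirac x₁ + ENNReal.ofReal w₂ • Measure.dirac x₂
    + ENNReal.ofReal w₃ • Measure.dirac x₃, ⟨?_⟩, fun n => ⟨?_, ?_⟩⟩
  · simp [← ENNReal.ofReal_add, h₁, h₂, h₃, add_nonneg, hw]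
  · exact ((hi n x₁ w₁).add_measure (hi n x₂ w₂)).add_measure (hi n x₃ w₃)
  · rw [integral_add_measure ((hi n x₁ w₁).add_measure (hi n x₂ w₂)) (hi n x₃ w₃),
      integral_add_measure (hi n x₁ w₁) (hi n x₂ w₂)]
    simp [integral_smul_measure, h₁, h₂, h₃]

/-- Solution of the truncated moment problem. -/
lemma exists_moments (c d : ℝ) (hd : 1 ≤ d) :
    ∃ μ : Measure ℝ, IsProbabilityMeasure μ ∧ (∀ n : ℕ, Integrable (fun x : ℝ => x ^ n) μ) ∧
      (∫ x, x ∂μ) = 0 ∧ (∫ x, x ^ 2 ∂μ) = 1 ∧ (∫ x, x ^ 3 ∂μ) = c ∧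
      (∫ x, x ^ 4 ∂μ) = c ^ 2 + d := by
  obtain ⟨r, hr0, hr⟩ : ∃ r : ℝ, 0 < r ∧ r ^ 2 = c ^ 2 + 4 * d :=
    ⟨Real.sqrt (c ^ 2 + 4 * d), Real.sqrt_pos.2 (by positivity), Real.sq_sqrt (by positivity)⟩
  have hcr : |c| ≤ r := abs_le_of_sq_le_sq (by nlinarith) hr0.le
  obtain ⟨hc1, hc2⟩ := abs_le.1 hcr
  have hdpos : 0 < d := by linarith
  obtain ⟨μ, hμ, h⟩ := three_point 0 ((c - r) / 2) ((c + r) / 2) (1 - 1 / d)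
    ((c + r) / 2 / (r * d)) ((r - c) / 2 / (r * d))
    (by rw [sub_nonneg, div_le_one hdpos]; exact hd)
    (div_nonneg (by linarith) (by positivity)) (div_nonneg (by linarith) (by positivity))
    (by field_simp; ring)
  have hd' : d = (r ^ 2 - c ^ 2) / 4 := by linarith
  have h1 := (h 1).2
  have h2 := (h 2).2
  have h3 := (h 3).2
  have h4 := (h 4).2
  simp only [pow_one] at h1
  refine ⟨μ, hμ, fun n => (h n).1, ?_, ?_, ?_, ?_⟩
  · rw [h1]; field_simp; ring
  · rw [h2]; field_simp; rw [hd']; ring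
  · rw [h3]; field_simp; rw [hd']; ring
  · rw [h4]; field_simp; rw [hd']; ring

lemma strict_ineq (ν : Measure ℝ) (hprob : IsProbabilityMeasure ν)
    (hi : ∀ n : ℕ, n ≤ 4 → Integrable (fun x : ℝ => x ^ n) ν)
    (hmean : (∫ x, x ∂ν) = 0) (hvar : (∫ x, x ^ 2 ∂ν) = 1)
    (hsupp : ∀ a b : ℝ, ν ({a, b}ᶜ) ≠ 0) :
    1 + (∫ x, x ^ 3 ∂ν) ^ 2 < ∫ x, x ^ 4 ∂ν := by
  set c := ∫ x, x ^ 3 ∂ν with hc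
  have i1 : Integrable (fun x : ℝ => x) ν := by simpa using hi 1 (by norm_num)
  have i2 := hi 2 (by norm_num)
  have i3 := hi 3 (by norm_num)
  have i4 := hi 4 (by norm_num)
  have e : ∀ x : ℝ, (x ^ 2 - c * x - 1) ^ 2 =
      x ^ 4 + (-2 * c) * x ^ 3 + (c ^ 2 - 2) * x ^ 2 + (2 * c) * x + 1 := fun x => by ring
  have I : Integrable (fun x : ℝ => (x ^ 2 - c * x - 1) ^ 2) ν := by
    simp_rw [e]
    exact (((i4.add (i3.const_mul _)).add (i2.const_mul _)).add (i1.const_mul _)).add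
      (integrable_const _)
  have E : ∫ x, (x ^ 2 - c * x - 1) ^ 2 ∂ν = (∫ x, x ^ 4 ∂ν) - c ^ 2 - 1 := by
    simp_rw [e]
    have j1 : Integrable (fun x : ℝ => x ^ 4 + (-2 * c) * x ^ 3) ν := i4.add (i3.const_mul _)
    have j2 : Integrable (fun x : ℝ => x ^ 4 + (-2 * c) * x ^ 3 + (c ^ 2 - 2) * x ^ 2) ν :=
      j1.add (i2.const_mul _)
    have j3 : Integrable (fun x : ℝ => x ^ 4 + (-2 * c) * x ^ 3 + (c ^ 2 - 2) * x ^ 2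
        + (2 * c) * x) ν := j2.add (i1.const_mul _)
    rw [integral_add j3 (integrable_const _), integral_add j2 (i1.const_mul _),
      integral_add j1 (i2.const_mul _), integral_add i4 (i3.const_mul _)]
    have l1 : ∫ x, (2 * c) * x ∂ν = 0 := by
      rw [integral_const_mul (2 * c) (fun x : ℝ => x), hmean, mul_zero]
    rw [l1]
    simp only [integral_const_mul, hvar, ← hc]
    simp
    ring
  have pos : 0 < ∫ x, (x ^ 2 - c * x - 1) ^ 2 ∂ν := by
    rw [integral_pos_iff_support_of_nonneg (fun x => by positivity) I, pos_iff_ne_zero]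
    intro h0
    refine hsupp ((c - Real.sqrt (c ^ 2 + 4)) / 2) ((c + Real.sqrt (c ^ 2 + 4)) / 2)
      (measure_mono_null ?_ h0)
    intro x hx hz
    apply hx
    have hz' : x ^ 2 - c * x - 1 = 0 := by simpa using hz
    have hs : Real.sqrt (c ^ 2 + 4) ^ 2 = c ^ 2 + 4 := Real.sq_sqrt (by positivity)
    have : (x - (c - Real.sqrt (c ^ 2 + 4)) / 2) * (x - (c + Real.sqrt (c ^ 2 + 4)) / 2) = 0 := by
      linear_combination hz' - hs / 4
    rcases mul_eq_zero.1 this with h | h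
    · left; linarith
    · right; rw [Set.mem_singleton_iff]; linarith
  linarith

lemma exists_t (c q : ℝ) (h : 1 + c ^ 2 < q) : ∃ t : ℝ, 0 < t ∧ t < 1 ∧
    (1 - t) ^ 3 + c ^ 2 < (1 - t) * (q - 6 * (1 - t) * t - 3 * t ^ 2) := by
  have h1 : ∀ᶠ t : ℝ in nhds 0,
      (1 - t) ^ 3 + c ^ 2 < (1 - t) * (q - 6 * (1 - t) * t - 3 * t ^ 2) :=
    ContinuousAt.eventually_lt (by fun_prop) (by fun_prop) (by simpa using h)
  have h2 : ∀ᶠ t : ℝ in nhds 0, t < 1 := eventually_lt_nhds (by norm_num)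
  have h3 : ∀ᶠ t : ℝ in nhdsWithin 0 (Set.Ioi 0), 0 < t := eventually_mem_nhdsWithin
  obtain ⟨t, ht⟩ := (h3.and ((h2.and h1).filter_mono nhdsWithin_le_nhds)).exists
  exact ⟨t, ht.1, ht.2.1, ht.2.2⟩

/-- **The matching lemma** (Corollary 1.29 of Tao-Vu): if `ξ` is a real random variable (with
law `ν`) of mean zero and variance `1` supported on at least three points, then there are
`0 < t < 1` and independent real random variables `ξ'` (mean zero, variance `1`, law `ν'`)
and `ξ_G` standard Gaussian, such that `ξ` matches `(1-t)^{1/2} ξ' + t^{1/2} ξ_G` to order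
`4`, i.e. all moments up to order `4` agree. -/
theorem matching_lemma
    (ν : Measure ℝ) (hprob : IsProbabilityMeasure ν)
    (hint : Integrable (fun x => x ^ 4) ν)
    (hmean : (∫ x, x ∂ν) = 0) (hvar : (∫ x, x ^ 2 ∂ν) = 1)
    (hsupp : ∀ a b : ℝ, ν ({a, b}ᶜ) ≠ 0) :
    ∃ t : ℝ, 0 < t ∧ t < 1 ∧
      ∃ ν' : Measure ℝ, IsProbabilityMeasure ν' ∧
        Integrable (fun x => x ^ 4) ν' ∧
        (∫ x, x ∂ν') = 0 ∧ (∫ x, x ^ 2 ∂ν') = 1 ∧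
        ∀ m : ℕ, m ≤ 4 →
          (∫ x, x ^ m ∂ν) =
            ∫ p : ℝ × ℝ, (Real.sqrt (1 - t) * p.1 + Real.sqrt t * p.2) ^ m
              ∂(ν'.prod (gaussianReal 0 1)) := by
  have hi : ∀ n : ℕ, n ≤ 4 → Integrable (fun x : ℝ => x ^ n) ν := by
    intro n hn
    refine Integrable.mono' (hint.add (integrable_const (1 : ℝ))) (by fun_prop) ?_
    filter_upwards with x
    simp only [norm_pow, Real.norm_eq_abs, Pi.add_apply]
    have h4 : x ^ 4 = |x| ^ 4 := by rw [← abs_pow, abs_of_nonneg (by positivity)]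
    rw [h4]
    rcases le_total |x| 1 with h | h
    · have := pow_le_one₀ (n := n) (abs_nonneg x) h
      have : 0 ≤ |x| ^ 4 := by positivity
      linarith
    · have := pow_le_pow_right₀ h hn
      linarith
  have hq := strict_ineq ν hprob hi hmean hvar hsupp
  set c := ∫ x, x ^ 3 ∂ν with hc
  set q := ∫ x, x ^ 4 ∂ν with hqdef
  obtain ⟨t, ht0, ht1, ht⟩ := exists_t c q hq
  obtain ⟨s, hs0, hs⟩ : ∃ s : ℝ, 0 < s ∧ s ^ 2 = 1 - t :=
    ⟨Real.sqrt (1 - t), Real.sqrt_pos.2 (by linarith), Real.sq_sqrt (by linarith)⟩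
  have hs' : Real.sqrt (1 - t) = s := by rw [← hs, Real.sqrt_sq hs0.le]
  have ht' : Real.sqrt t ^ 2 = t := Real.sq_sqrt ht0.le
  set u := Real.sqrt t with hu
  rw [← hs, ← ht'] at ht
  obtain ⟨μ, hμ, hμi, m1, m2, m3, m4⟩ := exists_moments (c / s ^ 3)
    ((q - 6 * s ^ 2 * u ^ 2 - 3 * (u ^ 2) ^ 2) / s ^ 4 - (c / s ^ 3) ^ 2) (by
      have : (q - 6 * s ^ 2 * u ^ 2 - 3 * (u ^ 2) ^ 2) / s ^ 4 - (c / s ^ 3) ^ 2 =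
        (s ^ 2 * (q - 6 * s ^ 2 * u ^ 2 - 3 * (u ^ 2) ^ 2) - c ^ 2) / s ^ 6 := by
        field_simp
      rw [this, le_div_iff₀ (by positivity)]
      nlinarith)
  obtain ⟨g1, g2, g3, g4⟩ := gauss_moments
  have hsu : s ^ 2 + u ^ 2 = 1 := by rw [hs, ht']; ring
  refine ⟨t, ht0, ht1, μ, hμ, hμi 4, m1, m2, fun m hm => ?_⟩
  rw [hs', prod_moment μ (gaussianReal 0 1) hμi gauss_integrable]
  interval_cases m
  · simp
  · simp [Finset.sum_range_succ, hmean, m1, g1]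
  · simp [Finset.sum_range_succ, hvar, m1, g1, m2, g2]
    linarith
  · simp [Finset.sum_range_succ, ← hc, m1, g1, m2, g2, m3, g3]
    field_simp
  · simp [Finset.sum_range_succ, ← hqdef, m1, g1, m2, g2, m3, g3, m4, g4, Nat.choose]
    field_simp
    ring
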